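/- ∫₀¹ √(a(s)) ds ≤ ∫₀¹ √(â(s)) ds, with equality if and only if A is concave on [0,1] (equivalently, A = Â on [0,1]). In particular x_* ≤ x_s, where x_s = √(2 log 2)·∫₀¹ √(â(s)) ds, with equality if and only if A is concave. -/

import Mathlib

open MeasureTheory Set Filter

/-- Riemann integrability of `a` on `[0,1]`, encoded via the Lebesgue criterion:
`a` is bounded on `[0,1]`, almost everywhere continuous on `[0,1]`, and (Lebesgue)
integrable on `[0,1]`. -/
def RiemannIntegrableOn01 (a : ℝ → ℝ) : Prop :=
  IntegrableOn a (Set.Icc 0 1) volume ∧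
  (∀ᵐ s ∂(volume.restrict (Set.Icc (0:ℝ) 1)), ContinuousAt a s) ∧
  ∃ C : ℝ, ∀ s ∈ Set.Icc (0:ℝ) 1, |a s| ≤ C

theorem integrable_sqrt {α : Type*} [MeasurableSpace α] {μ : Measure α} [IsFiniteMeasure μ]
    {f : α → ℝ} (hf : Integrable f μ) : Integrable (fun x => √(f x)) μ := by
  refine ((integrable_const (1 : ℝ)).add hf.norm).mono'
    (Real.continuous_sqrt.comp_aestronglyMeasurable hf.1) (Eventually.of_forall fun x => ?_)
  rw [Real.norm_of_nonneg (Real.sqrt_nonneg _), Pi.add_apply]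
  have h1 := Real.le_norm_self (f x)
  have h2 := norm_nonneg (f x)
  exact Real.sqrt_le_iff.2 ⟨by positivity, by nlinarith⟩

/-- If nonnegative `f` and `g` have the same integrals over all superlevel sets of `g`, they have
the same integrals against all nonnegative functions of `g`. -/
theorem lintegral_mul_comp_eq_of_setIntegral_superlevel_eq {α : Type*} [MeasurableSpace α]
    {μ : Measure α} {f g : α → ℝ} (hf : Integrable f μ) (hg : Integrable g μ)
    (hgm : Measurable g) (hf0 : 0 ≤ᵐ[μ] f) (hg0 : 0 ≤ᵐ[μ] g)
    (h : ∀ c, ∫ x in {x | c ≤ g x}, f x ∂μ = ∫ x in {x | c ≤ g x}, g x ∂μ)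
    {φ : ℝ → ENNReal} (hφ : Measurable φ) :
    ∫⁻ x, ENNReal.ofReal (f x) * φ (g x) ∂μ = ∫⁻ x, ENNReal.ofReal (g x) * φ (g x) ∂μ := by
  have key : (μ.withDensity fun x => ENNReal.ofReal (f x)).map g
      = (μ.withDensity fun x => ENNReal.ofReal (g x)).map g := by
    have := isFiniteMeasure_withDensity_ofReal hf.2
    refine Measure.ext_of_Ici _ _ fun c => ?_
    have hs : MeasurableSet {x | c ≤ g x} := hgm measurableSet_Ici
    rw [Measure.map_apply hgm measurableSet_Ici, Measure.map_apply hgm measurableSet_Ici]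
    change (μ.withDensity _) {x | c ≤ g x} = (μ.withDensity _) {x | c ≤ g x}
    rw [withDensity_apply _ hs, withDensity_apply _ hs,
      ← ofReal_integral_eq_lintegral_ofReal hf.integrableOn (ae_restrict_of_ae hf0),
      ← ofReal_integral_eq_lintegral_ofReal hg.integrableOn (ae_restrict_of_ae hg0), h c]
  have e : ∀ k : α → ℝ, Integrable k μ → ∫⁻ x, ENNReal.ofReal (k x) * φ (g x) ∂μ
      = ∫⁻ y, φ y ∂((μ.withDensity fun x => ENNReal.ofReal (k x)).map g) := by
    intro k hk
    rw [lintegral_map hφ hgm, lintegral_withDensity_eq_lintegral_mul₀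
      hk.1.aemeasurable.ennreal_ofReal (g := fun x => φ (g x)) (hφ.comp hgm).aemeasurable]
    rfl
  rw [e f hf, e g hg, key]

/-- Jensen's inequality for the square root, with its equality case, where `g` is the conditional
expectation of `f` given the level sets of `g`. -/
theorem integral_sqrt_le_of_setIntegral_superlevel_eq {α : Type*} [MeasurableSpace α]
    {μ : Measure α} [IsFiniteMeasure μ] {f g : α → ℝ} (hf : Integrable f μ) (hg : Integrable g μ)
    (hgm : Measurable g) (hf0 : 0 ≤ᵐ[μ] f) (hg0 : 0 ≤ᵐ[μ] g)
    (h : ∀ c, ∫ x in {x | c ≤ g x}, f x ∂μ = ∫ x in {x | c ≤ g x}, g x ∂μ) :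
    ∫ x, √(f x) ∂μ ≤ ∫ x, √(g x) ∂μ ∧
      (∫ x, √(f x) ∂μ = ∫ x, √(g x) ∂μ → f =ᵐ[μ] g) := by
  have hzero : ∀ᵐ x ∂μ, g x = 0 → f x = 0 := by
    have hφ : Measurable ((Iic (0 : ℝ)).indicator (1 : ℝ → ENNReal)) :=
      measurable_one.indicator measurableSet_Iic
    have h1 := lintegral_mul_comp_eq_of_setIntegral_superlevel_eq hf hg hgm hf0 hg0 h hφ
    have h2 : ∀ x, ENNReal.ofReal (g x) * (Iic (0 : ℝ)).indicator 1 (g x) = 0 := fun x => by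
      by_cases hx : g x ≤ 0
      · simp [ENNReal.ofReal_of_nonpos hx]
      · simp [hx]
    simp only [h2, lintegral_zero] at h1
    rw [lintegral_eq_zero_iff' (f := fun x => ENNReal.ofReal (f x) * (Iic (0 : ℝ)).indicator 1 (g x))
      (hf.1.aemeasurable.ennreal_ofReal.mul (hφ.comp hgm).aemeasurable)] at h1
    filter_upwards [h1, hf0] with x hx hx0 hgx
    simp only [hgx, Pi.zero_apply, mem_Iic, le_refl, indicator_of_mem, Pi.one_apply, mul_one,
      ENNReal.ofReal_eq_zero] at hx
    exact le_antisymm hx hx0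
  have hsg := integrable_sqrt hg
  have hsf := integrable_sqrt hf
  have hm : Measurable fun y : ℝ => (√y)⁻¹ := Real.continuous_sqrt.measurable.inv
  have heq := lintegral_mul_comp_eq_of_setIntegral_superlevel_eq hf hg hgm hf0 hg0 h
      (φ := fun y => ENNReal.ofReal (√y)⁻¹) hm.ennreal_ofReal
  have hk0 : 0 ≤ᵐ[μ] fun x => f x * (√(g x))⁻¹ := by
    filter_upwards [hf0] with x hx
    exact mul_nonneg hx (by positivity)
  have e1 : ∫⁻ x, ENNReal.ofReal (f x * (√(g x))⁻¹) ∂μ = ∫⁻ x, ENNReal.ofReal (√(g x)) ∂μ := by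
    rw [lintegral_congr_ae (g := fun x => ENNReal.ofReal (f x) * ENNReal.ofReal (√(g x))⁻¹),
      heq]
    · refine lintegral_congr_ae ?_
      filter_upwards [hg0] with x hx
      rw [← ENNReal.ofReal_mul hx, ← div_eq_mul_inv, Real.div_sqrt]
    · filter_upwards [hf0] with x hx
      rw [ENNReal.ofReal_mul hx]
  have hk : Integrable (fun x => f x * (√(g x))⁻¹) μ := by
    refine ⟨hf.1.mul (hm.comp hgm).aestronglyMeasurable, ?_⟩
    rw [hasFiniteIntegral_iff_ofReal hk0, e1,
      ← hasFiniteIntegral_iff_ofReal (Eventually.of_forall fun x => Real.sqrt_nonneg _)]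
    exact hsg.2
  have e2 : ∫ x, f x * (√(g x))⁻¹ ∂μ = ∫ x, √(g x) ∂μ := by
    rw [integral_eq_lintegral_of_nonneg_ae hk0 hk.1, e1, integral_eq_lintegral_of_nonneg_ae
      (Eventually.of_forall fun x => Real.sqrt_nonneg _) hsg.1]
  have hK : Integrable (fun x => (√(g x) + f x * (√(g x))⁻¹) / 2) μ := (hsg.add hk).div_const 2
  have e3 : ∫ x, (√(g x) + f x * (√(g x))⁻¹) / 2 ∂μ = ∫ x, √(g x) ∂μ := by
    rw [integral_div, integral_add hsg hk, e2]; ring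
  have sq : ∀ x, 0 ≤ f x → 0 < g x →
      (√(g x) + f x * (√(g x))⁻¹) / 2 - √(f x) = (√(f x) - √(g x)) ^ 2 / (2 * √(g x)) := by
    intro x hx hgx
    have := Real.sqrt_pos.2 hgx
    have h2 := Real.sq_sqrt hx
    field_simp
    linear_combination -h2
  have hle : (fun x => √(f x)) ≤ᵐ[μ] fun x => (√(g x) + f x * (√(g x))⁻¹) / 2 := by
    filter_upwards [hzero, hf0, hg0] with x hx hfx hgx
    rcases eq_or_lt_of_le (show 0 ≤ g x from hgx) with h0 | h0
    · simp [hx h0.symm, ← h0]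
    · have := sq x hfx h0
      have : 0 ≤ (√(f x) - √(g x)) ^ 2 / (2 * √(g x)) := by positivity
      linarith
  refine ⟨e3 ▸ integral_mono_ae hsf hK hle, fun hE => ?_⟩
  rw [← e3, integral_eq_iff_of_ae_le hsf hK hle] at hE
  filter_upwards [hE, hzero, hf0, hg0] with x hE hx hfx hgx
  rcases eq_or_lt_of_le (show 0 ≤ g x from hgx) with h0 | h0
  · rw [hx h0.symm, h0]
  · have h1 := sq x hfx h0
    have h2 := Real.sqrt_pos.2 h0
    rw [← hE, sub_self, eq_comm, div_eq_zero_iff] at h1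
    have h3 : √(f x) = √(g x) := by
      rcases h1 with h1 | h1
      · linarith [pow_eq_zero_iff (two_ne_zero) |>.1 h1]
      · linarith
    exact (Real.sqrt_inj hfx hgx).1 h3

/-- Fundamental theorem of calculus for a function with a left derivative. -/
theorem integral_eq_sub_of_hasDeriv_left_of_le {f f' : ℝ → ℝ} {a b : ℝ} (hab : a ≤ b)
    (hcont : ContinuousOn f (Icc a b))
    (hderiv : ∀ x ∈ Ioo a b, HasDerivWithinAt f (f' x) (Iio x) x)
    (hint : IntervalIntegrable f' volume a b) : ∫ y in a..b, f' y = f b - f a := by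
  have h := intervalIntegral.integral_eq_sub_of_hasDeriv_right_of_le (neg_le_neg hab)
    (f := fun x => -f (-x)) (f' := fun x => f' (-x)) ?_ ?_ ?_
  · rw [intervalIntegral.integral_comp_neg] at h
    simpa [add_comm, ← sub_eq_add_neg] using h
  · refine (hcont.comp continuous_neg.continuousOn fun x hx => ?_).neg
    exact ⟨by linarith [hx.2], by linarith [hx.1]⟩
  · intro x hx
    have h1 := hderiv (-x) ⟨by linarith [hx.2], by linarith [hx.1]⟩
    have h2 : HasDerivWithinAt (fun y : ℝ => -y) (-1) (Ioi x) x :=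
      (hasDerivAt_neg x).hasDerivWithinAt
    have h3 := (HasDerivWithinAt.scomp x h1 h2
      (fun y hy => neg_lt_neg (show x < y from hy))).neg
    simpa [Function.comp_def, Pi.neg_def] using h3
  · simpa using hint.symm.comp_sub_left 0

theorem concaveOn_affine (s : Set ℝ) (hs : Convex ℝ s) (p m u : ℝ) :
    ConcaveOn ℝ s fun x => p + m * (x - u) := by
  refine ⟨hs, fun x _ y _ a b _ _ hab => le_of_eq ?_⟩
  simp only [smul_eq_mul]
  linear_combination (p - m * u) * hab

/-- Wherever the least concave majorant `F` of a continuous function `A` lies strictly above `A`,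
it is locally affine. -/
theorem exists_affine_of_lt_least_concave_majorant {A F : ℝ → ℝ} {s : Set ℝ}
    (hA : ContinuousOn A s) (hF : ConcaveOn ℝ s F) (hge : ∀ t ∈ s, A t ≤ F t)
    (hleast : ∀ g : ℝ → ℝ, ConcaveOn ℝ s g → (∀ t ∈ s, A t ≤ g t) → ∀ t ∈ s, F t ≤ g t)
    {τ : ℝ} (hτ : s ∈ nhds τ) (hlt : A τ < F τ) :
    ∃ u v m : ℝ, u < τ ∧ τ < v ∧ Icc u v ⊆ s ∧ ∀ x ∈ Icc u v, F x = F u + m * (x - u) := by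
  obtain ⟨M, hAM, hMF⟩ := exists_between hlt
  have hFc : ContinuousAt F τ :=
    hF.continuousOn_interior.continuousAt (isOpen_interior.mem_nhds (mem_interior_iff_mem_nhds.2 hτ))
  have hev : ∀ᶠ x in nhds τ, x ∈ s ∧ A x < M ∧ M < F x :=
    Filter.Eventually.and hτ (((hA.continuousAt hτ).eventually_lt_const hAM).and
      (hFc.eventually_const_lt hMF))
  obtain ⟨l, r, ⟨hl, hr⟩, hsub⟩ := mem_nhds_iff_exists_Ioo_subset.1 hev
  obtain ⟨u, hlu, huτ⟩ := exists_between hl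
  obtain ⟨v, hτv, hvr⟩ := exists_between hr
  have hIcc : ∀ x ∈ Icc u v, x ∈ s ∧ A x < M ∧ M < F x := fun x hx =>
    hsub ⟨hlu.trans_le hx.1, hx.2.trans_lt hvr⟩
  have huv : u < v := huτ.trans hτv
  obtain ⟨hu, -, hMu⟩ := hIcc u (left_mem_Icc.2 huv.le)
  obtain ⟨hv, -, hMv⟩ := hIcc v (right_mem_Icc.2 huv.le)
  have three : ∀ p q r, p ∈ s → r ∈ s → p < q → q < r →
      (F r - F q) * (q - p) ≤ (F q - F p) * (r - q) := fun p q r hp hr hpq hqr => by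
    have := hF.slope_anti_adjacent hp hr hpq hqr
    rwa [div_le_div_iff₀ (sub_pos.2 hqr) (sub_pos.2 hpq)] at this
  obtain ⟨m, hm⟩ : ∃ m, m * (v - u) = F v - F u :=
    ⟨(F v - F u) / (v - u), div_mul_cancel₀ _ (sub_pos.2 huv).ne'⟩
  have hinside : ∀ x ∈ Icc u v, F u + m * (x - u) ≤ F x := by
    rintro x ⟨hx1, hx2⟩
    rcases hx1.eq_or_lt with rfl | hx1
    · simp
    rcases hx2.eq_or_lt with rfl | hx2
    · linarith
    have := three u x v hu hv hx1 hx2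
    refine le_of_mul_le_mul_right ?_ (sub_pos.2 huv)
    linear_combination this + (x - u) * hm
  have houtside : ∀ x ∈ s, x ∉ Icc u v → F x ≤ F u + m * (x - u) := by
    intro x hx hx'
    refine le_of_mul_le_mul_right ?_ (sub_pos.2 huv)
    rcases lt_or_ge x u with h | h
    · have := three x u v hx hv h huv
      linear_combination this - (x - u) * hm
    · have hvx : v < x := lt_of_not_ge fun h' => hx' ⟨h, h'⟩
      have := three u v x hu hx huv hvx
      linear_combination this - (x - u) * hm
  have hmin := hleast _ (hF.inf (concaveOn_affine s hF.1 (F u) m u)) fun t ht => by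
    refine le_inf (hge t ht) ?_
    by_cases h : t ∈ Icc u v
    · have h1 := (hIcc t h).2.1
      have h2 : M * (v - u) ≤ (F u + m * (t - u)) * (v - u) := by
        have e : (F u + m * (t - u)) * (v - u) = F u * (v - t) + F v * (t - u) := by
          linear_combination (t - u) * hm
        rw [e]
        nlinarith [mul_nonneg (sub_nonneg.2 hMu.le) (sub_nonneg.2 h.2),
          mul_nonneg (sub_nonneg.2 hMv.le) (sub_nonneg.2 h.1)]
      exact h1.le.trans (le_of_mul_le_mul_right h2 (sub_pos.2 huv))
    · exact (hge t ht).trans (houtside t ht h)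
  exact ⟨u, v, m, huτ, hτv, fun x hx => (hIcc x hx).1, fun x hx =>
    le_antisymm ((hmin x (hIcc x hx).1).trans inf_le_right) (hinside x hx)⟩

theorem stmt11 (a A Ahat ahat : ℝ → ℝ)
    (ha_nonneg : ∀ s ∈ Set.Icc (0:ℝ) 1, 0 ≤ a s)
    (ha_int : RiemannIntegrableOn01 a)
    (hA : ∀ t ∈ Set.Icc (0:ℝ) 1, A t = ∫ s in (0:ℝ)..t, a s)
    (hA1 : A 1 = 1)
    (hAhat_conc : ConcaveOn ℝ (Set.Icc 0 1) Ahat)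
    (hAhat_ge : ∀ t ∈ Set.Icc (0:ℝ) 1, A t ≤ Ahat t)
    (hAhat_least : ∀ g : ℝ → ℝ, ConcaveOn ℝ (Set.Icc 0 1) g →
      (∀ t ∈ Set.Icc (0:ℝ) 1, A t ≤ g t) → ∀ t ∈ Set.Icc (0:ℝ) 1, Ahat t ≤ g t)
    (hahat_deriv : ∀ t ∈ Set.Ioc (0:ℝ) 1, HasDerivWithinAt Ahat (ahat t) (Set.Iic t) t)
    (hahat_nonneg : ∀ t ∈ Set.Ioc (0:ℝ) 1, 0 ≤ ahat t)
    (hahat_anti : AntitoneOn ahat (Set.Ioc 0 1)) :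
    ((∫ s in Set.Ioc (0:ℝ) 1, Real.sqrt (a s)) ≤ ∫ s in Set.Ioc (0:ℝ) 1, Real.sqrt (ahat s)) ∧
    ((∫ s in Set.Ioc (0:ℝ) 1, Real.sqrt (a s)) = (∫ s in Set.Ioc (0:ℝ) 1, Real.sqrt (ahat s))
      ↔ ConcaveOn ℝ (Set.Icc 0 1) A) ∧
    (ConcaveOn ℝ (Set.Icc 0 1) A ↔ ∀ t ∈ Set.Icc (0:ℝ) 1, A t = Ahat t) ∧
    (Real.sqrt (2 * Real.log 2) * ∫ s in Set.Ioc (0:ℝ) 1, Real.sqrt (a s)) ≤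
      Real.sqrt (2 * Real.log 2) * ∫ s in Set.Ioc (0:ℝ) 1, Real.sqrt (ahat s) ∧
    ((Real.sqrt (2 * Real.log 2) * ∫ s in Set.Ioc (0:ℝ) 1, Real.sqrt (a s)) =
        (Real.sqrt (2 * Real.log 2) * ∫ s in Set.Ioc (0:ℝ) 1, Real.sqrt (ahat s))
      ↔ ConcaveOn ℝ (Set.Icc 0 1) A) := by
  obtain ⟨hint, hcont, C, hC⟩ := ha_int
  have h0mem : (0 : ℝ) ∈ Icc (0 : ℝ) 1 := left_mem_Icc.2 zero_le_one
  have h1mem : (1 : ℝ) ∈ Icc (0 : ℝ) 1 := right_mem_Icc.2 zero_le_one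
  have hII : ∀ t ∈ Icc (0 : ℝ) 1, IntervalIntegrable a volume 0 t := fun t ht =>
    (intervalIntegrable_iff_integrableOn_Ioc_of_le ht.1).2
      (hint.mono_set fun x hx => ⟨hx.1.le, hx.2.trans ht.2⟩)
  have hA0 : A 0 = 0 := by simp [hA 0 h0mem]
  have hAcont : ContinuousOn A (Icc 0 1) := by
    have := intervalIntegral.continuousOn_primitive_interval (f := a) (a := 0) (b := 1)
      (μ := volume) (by rwa [uIcc_of_le zero_le_one])
    rw [uIcc_of_le zero_le_one] at this
    exact this.congr hA
  have hAnn : ∀ t ∈ Icc (0 : ℝ) 1, 0 ≤ A t := fun t ht => by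
    rw [hA t ht]
    exact intervalIntegral.integral_nonneg ht.1 fun x hx => ha_nonneg x ⟨hx.1, hx.2.trans ht.2⟩
  have hAC : ∀ t ∈ Icc (0 : ℝ) 1, A t ≤ C * t := fun t ht => by
    rw [hA t ht]
    calc ∫ s in (0 : ℝ)..t, a s ≤ ∫ _ in (0 : ℝ)..t, C :=
          intervalIntegral.integral_mono_on ht.1 (hII t ht) intervalIntegrable_const
            fun x hx => (le_abs_self _).trans (hC x ⟨hx.1, hx.2.trans ht.2⟩)
      _ = C * t := by simp [mul_comm]
  have hFC : ∀ t ∈ Icc (0 : ℝ) 1, Ahat t ≤ C * t :=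
    hAhat_least _ (by simpa using concaveOn_affine (Icc 0 1) (convex_Icc 0 1) 0 C 0) hAC
  have hF0 : Ahat 0 = 0 :=
    le_antisymm (by simpa using hFC 0 h0mem) (hA0.ge.trans (hAhat_ge 0 h0mem))
  have hA_le_one : ∀ t ∈ Icc (0 : ℝ) 1, A t ≤ 1 := fun t ht => by
    have h := intervalIntegral.integral_add_adjacent_intervals (hII t ht)
      ((hII t ht).symm.trans (hII 1 h1mem))
    rw [← hA t ht, ← hA 1 h1mem, hA1] at h
    have : 0 ≤ ∫ s in t..1, a s :=
      intervalIntegral.integral_nonneg ht.2 fun x hx => ha_nonneg x ⟨ht.1.trans hx.1, hx.2⟩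
    linarith
  have hF1 : Ahat 1 = 1 :=
    le_antisymm (hAhat_least _ (concaveOn_const 1 (convex_Icc 0 1)) hA_le_one 1 h1mem)
      (hA1.ge.trans (hAhat_ge 1 h1mem))
  have hFcont : ContinuousOn Ahat (Icc 0 1) := by
    refine hAhat_conc.continuousOn_Icc one_pos ?_ ?_
    · have hz : ∀ᶠ x in nhdsWithin (0 : ℝ) (Ici 0), x ∈ Icc (0 : ℝ) 1 :=
        Icc_mem_nhdsGE one_pos
      have hl : Tendsto (fun x : ℝ => C * x) (nhdsWithin 0 (Ici 0)) (nhds 0) := by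
        have : ContinuousAt (fun x : ℝ => C * x) 0 := by fun_prop
        simpa using this.tendsto.mono_left nhdsWithin_le_nhds
      rw [ContinuousWithinAt, hF0]
      exact tendsto_of_tendsto_of_tendsto_of_le_of_le' tendsto_const_nhds hl
        (hz.mono fun x hx => (hAnn x hx).trans (hAhat_ge x hx)) (hz.mono hFC)
    · exact (hahat_deriv 1 ⟨one_pos, le_rfl⟩).continuousWithinAt
  have hahatC : ∀ t ∈ Ioc (0 : ℝ) 1, ahat t ≤ C := fun t ht => by
    have h := hAhat_conc.le_slope_of_hasDerivWithinAt_Iio h0mem (Ioc_subset_Icc_self ht) ht.1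
      ((hahat_deriv t ht).mono Iio_subset_Iic_self)
    rw [slope_def_field, hF0, sub_zero, sub_zero] at h
    exact h.trans ((div_le_iff₀ ht.1).2 (hFC t (Ioc_subset_Icc_self ht)))
  obtain ⟨b, hb, hEq⟩ := hahat_anti.exists_antitone_extension
    ⟨0, by rintro _ ⟨t, ht, rfl⟩; exact hahat_nonneg t ht⟩
    ⟨C, by rintro _ ⟨t, ht, rfl⟩; exact hahatC t ht⟩
  have hbi : ∀ u v : ℝ, IntervalIntegrable b volume u v := fun u v => hb.intervalIntegrable
  have hFtc : ∀ t ∈ Icc (0 : ℝ) 1, ∫ s in (0 : ℝ)..t, b s = Ahat t := fun t ht => by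
    rw [integral_eq_sub_of_hasDeriv_left_of_le ht.1
      (hFcont.mono (Icc_subset_Icc_right ht.2)) (fun x hx => ?_) (hbi 0 t), hF0, sub_zero]
    have hx' : x ∈ Ioc (0 : ℝ) 1 := ⟨hx.1, hx.2.le.trans ht.2⟩
    rw [← hEq hx']
    exact (hahat_deriv x hx').mono Iio_subset_Iic_self
  have hcontact : ∀ c : ℝ, ∃ τ ∈ Icc (0 : ℝ) 1, A τ = Ahat τ ∧
      Ioo 0 τ ⊆ {x | c ≤ b x} ∩ Ioc 0 1 ∧ {x | c ≤ b x} ∩ Ioc 0 1 ⊆ Ioc 0 τ := by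
    intro c
    rcases ({x | c ≤ b x} ∩ Ioc (0 : ℝ) 1).eq_empty_or_nonempty with hT | ⟨z, hz⟩
    · exact ⟨0, h0mem, by rw [hA0, hF0], by simp, by simp [hT]⟩
    set T := {x | c ≤ b x} ∩ Ioc (0 : ℝ) 1 with hTdef
    have hbdd : BddAbove T := ⟨1, fun x hx => hx.2.2⟩
    have hτ0 : 0 < sSup T := hz.2.1.trans_le (le_csSup hbdd hz)
    have hτ1 : sSup T ≤ 1 := csSup_le ⟨z, hz⟩ fun x hx => hx.2.2
    refine ⟨sSup T, ⟨hτ0.le, hτ1⟩, ?_, fun x hx => ?_, fun x hx => ⟨hx.2.1, le_csSup hbdd hx⟩⟩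
    · rcases hτ1.eq_or_lt with h1 | h1
      · rw [h1, hA1, hF1]
      by_contra hne
      obtain ⟨u, v, m, hu, hv, hsub, haff⟩ := exists_affine_of_lt_least_concave_majorant hAcont
        hAhat_conc hAhat_ge hAhat_least (Icc_mem_nhds hτ0 h1)
        (lt_of_le_of_ne (hAhat_ge _ ⟨hτ0.le, hτ1⟩) hne)
      have huv : u < v := hu.trans hv
      have hu0 : 0 ≤ u := (hsub (left_mem_Icc.2 huv.le)).1
      have hv1 : v ≤ 1 := (hsub (right_mem_Icc.2 huv.le)).2
      have hconst : ∀ x ∈ Ioc u v, b x = m := fun x hx => by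
        have hx' : x ∈ Ioc (0 : ℝ) 1 := ⟨hu0.trans_lt hx.1, hx.2.trans hv1⟩
        rw [← hEq hx']
        have hl : HasDerivWithinAt (fun y => Ahat u + m * (y - u)) m (Iic x) x := by
          simpa using ((((hasDerivAt_id x).sub_const u).const_mul m).const_add
            (Ahat u)).hasDerivWithinAt (s := Iic x)
        refine (uniqueDiffWithinAt_Iic x).eq_deriv _ (hahat_deriv x hx')
          (hl.congr_of_eventuallyEq ?_ (haff x ⟨hx.1.le, hx.2⟩))
        filter_upwards [Icc_mem_nhdsLE hx.1] with y hy using haff y ⟨hy.1, hy.2.trans hx.2⟩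
      obtain ⟨x, hxT, hux⟩ := exists_lt_of_lt_csSup ⟨z, hz⟩ hu
      have hxv : x ≤ v := (le_csSup hbdd hxT).trans hv.le
      have hvT : v ∈ T := by
        refine ⟨?_, hu0.trans_lt huv, hv1⟩
        have h2 : c ≤ b x := hxT.1
        rw [hconst x ⟨hux, hxv⟩] at h2
        change c ≤ b v
        rwa [hconst v ⟨huv, le_rfl⟩]
      exact absurd (le_csSup hbdd hvT) (not_le.2 hv)
    · obtain ⟨y, hyT, hxy⟩ := exists_lt_of_lt_csSup ⟨z, hz⟩ hx.2
      exact ⟨le_trans hyT.1 (hb hxy.le), hx.1, hx.2.le.trans hτ1⟩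
  have hsuper : ∀ c, ∫ x in {x | c ≤ b x}, a x ∂(volume.restrict (Ioc 0 1))
      = ∫ x in {x | c ≤ b x}, b x ∂(volume.restrict (Ioc 0 1)) := fun c => by
    obtain ⟨τ, hτ, hAF, hsub1, hsub2⟩ := hcontact c
    have hae : ({x | c ≤ b x} ∩ Ioc 0 1 : Set ℝ) =ᵐ[volume] Ioc 0 τ :=
      hsub2.eventuallyLE.antisymm (Ioo_ae_eq_Ioc.symm.le.trans hsub1.eventuallyLE)
    have hmeas : MeasurableSet {x | c ≤ b x} := hb.measurable measurableSet_Ici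
    rw [Measure.restrict_restrict hmeas,
      setIntegral_congr_set hae, setIntegral_congr_set hae,
      ← intervalIntegral.integral_of_le hτ.1, ← intervalIntegral.integral_of_le hτ.1,
      ← hA τ hτ, hFtc τ hτ, hAF]
  have hf0 : 0 ≤ᵐ[volume.restrict (Ioc 0 1)] a :=
    (ae_restrict_iff' measurableSet_Ioc).2
      (Eventually.of_forall fun x hx => ha_nonneg x (Ioc_subset_Icc_self hx))
  have hg0 : 0 ≤ᵐ[volume.restrict (Ioc 0 1)] b :=
    (ae_restrict_iff' measurableSet_Ioc).2
      (Eventually.of_forall fun x hx => (hEq hx) ▸ hahat_nonneg x hx)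
  have hbint : IntegrableOn b (Ioc 0 1) volume :=
    (intervalIntegrable_iff_integrableOn_Ioc_of_le zero_le_one).1 (hbi 0 1)
  obtain ⟨hle, heq⟩ := integral_sqrt_le_of_setIntegral_superlevel_eq
    (hint.mono_set Ioc_subset_Icc_self) hbint hb.measurable hf0 hg0 hsuper
  have hsqrt : ∫ s in Ioc (0 : ℝ) 1, √(ahat s) = ∫ s in Ioc (0 : ℝ) 1, √(b s) :=
    setIntegral_congr_fun measurableSet_Ioc fun x hx => by simp only [hEq hx]
  have hconc : ConcaveOn ℝ (Icc 0 1) A ↔ ∀ t ∈ Icc (0 : ℝ) 1, A t = Ahat t :=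
    ⟨fun h t ht => le_antisymm (hAhat_ge t ht) (hAhat_least A h (fun _ _ => le_rfl) t ht),
      fun h => hAhat_conc.congr fun t ht => (h t ht).symm⟩
  have hiff : (∫ s in Ioc (0 : ℝ) 1, √(a s)) = (∫ s in Ioc (0 : ℝ) 1, √(ahat s))
      ↔ ConcaveOn ℝ (Icc 0 1) A := by
    rw [hsqrt, hconc]
    refine ⟨fun h t ht => ?_, fun h => ?_⟩
    · rw [hA t ht, ← hFtc t ht, intervalIntegral.integral_of_le ht.1,
        intervalIntegral.integral_of_le ht.1]
      exact integral_congr_ae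
        (ae_mono (Measure.restrict_mono (Ioc_subset_Ioc_right ht.2) le_rfl) (heq h))
    · refine integral_congr_ae ?_
      rw [← Measure.restrict_congr_set (Ioo_ae_eq_Ioc (μ := volume))]
      filter_upwards [ae_restrict_mem measurableSet_Ioo,
        ae_mono (Measure.restrict_mono Ioo_subset_Icc_self le_rfl) hcont] with t ht htc
      have hnhds : Icc (0 : ℝ) 1 ∈ nhds t := Icc_mem_nhds ht.1 ht.2
      have h1 : HasDerivAt (fun u => ∫ s in (0 : ℝ)..u, a s) (a t) t :=
        intervalIntegral.integral_hasDerivAt_right (hII t (Ioo_subset_Icc_self ht))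
          ⟨Icc 0 1, hnhds, hint.1⟩ htc
      have h2 : HasDerivAt Ahat (a t) t := h1.congr_of_eventuallyEq <| by
        filter_upwards [hnhds] with x hx
        rw [← h x hx, hA x hx]
      have h3 : ahat t = a t := (uniqueDiffWithinAt_Iic t).eq_deriv _
        (hahat_deriv t (Ioo_subset_Ioc_self ht)) h2.hasDerivWithinAt
      rw [← hEq (Ioo_subset_Ioc_self ht), h3]
  have hpos : 0 < √(2 * Real.log 2) :=
    Real.sqrt_pos.2 (mul_pos two_pos (Real.log_pos one_lt_two))
  rw [← hsqrt] at hle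
  exact ⟨hle, hiff, hconc, mul_le_mul_of_nonneg_left hle hpos.le,
    (mul_right_inj' hpos.ne').trans hiff⟩
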